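/- For every integer d ≥ 0 and every closed subset Θ ⊆ Ω^∞_{⟨d]}, the truncated differential ∂^∞ maps the free ℤ-module ℤ[Θ] into itself, satisfies ∂^∞∘∂^∞ = 0, and sends each basis element x to a ℤ-linear combination of marked compositions of reduced norm |x|' + 1; thus (ℤ[Θ], ∂^∞) is a differential complex graded by reduced norm. -/

import Mathlib

/-- A composition: a (possibly empty) list of positive integers. -/
abbrev Comp : Type := List PNat

/-- A marked composition: a composition together with a mark `κ : ℕ`. -/
abbrev MComp : Type := List PNat × ℕ

/-- The norm `|ω|` of a composition. -/
def normC (ω : Comp) : ℕ := (ω.map fun a => (a : ℕ)).sum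

/-- The reduced norm `|ω|' = |ω| - ℓ` of a composition. -/
def rnormC (ω : Comp) : ℕ := normC ω - ω.length

/-- The norm of a marked composition. -/
def normM (x : MComp) : ℕ := normC x.1 + x.2

/-- The reduced norm of a marked composition. -/
def rnormM (x : MComp) : ℕ := rnormC x.1 + x.2

/-- Merge the parts at (0-indexed) positions `k` and `k+1` of a composition. -/
def mergeAux : Comp → ℕ → Comp
  | a :: b :: t, 0 => (a + b) :: t
  | a :: t, n + 1 => a :: mergeAux t n
  | l, _ => l

/-- The merge operation `M_k^∞` (`0 ≤ k ≤ ℓ`) on marked compositions: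
`M_0^∞` moves the first part to the mark, `M_ℓ^∞` moves the last part to the mark, and
for `1 ≤ k ≤ ℓ-1`, `M_k^∞` merges the `k`-th and `(k+1)`-st parts (1-indexed). -/
def mergeM (x : MComp) (k : ℕ) : MComp :=
  if k = 0 then
    match x.1 with
    | [] => x
    | a :: t => (t, x.2 + (a : ℕ))
  else if k = x.1.length then
    match x.1.getLast? with
    | none => x
    | some a => (x.1.dropLast, x.2 + (a : ℕ))
  else (mergeAux x.1 (k - 1), x.2)

/-- The insert operation `I_k` (`0 ≤ k ≤ ℓ`): insert a part `2` after the first `k` parts. -/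
def insertC (ω : Comp) (k : ℕ) : Comp := ω.take k ++ (2 : PNat) :: ω.drop k

/-- The insert operation `I_k^∞` on marked compositions. -/
def insertM (x : MComp) (k : ℕ) : MComp := (insertC x.1 k, x.2)

/-- One merge or insert step on marked compositions: `mstep y x` means `x` is
obtained from `y` by a single operation. -/
def mstep (y x : MComp) : Prop :=
  (∃ k ≤ y.1.length, y.1 ≠ [] ∧ x = mergeM y k) ∨ ∃ k ≤ y.1.length, x = insertM y k

/-- `mprec x y` is the relation `x ⪯ y` on marked compositions. -/
def mprec (x y : MComp) : Prop := Relation.ReflTransGen mstep y x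

/-- One merge or insert step on compositions: merges `M_j`, `1 ≤ j ≤ ℓ-1`
(0-indexed: positions `k, k+1` with `k + 2 ≤ ℓ`), and all inserts. -/
def cstep (y x : Comp) : Prop :=
  (∃ k, k + 2 ≤ y.length ∧ x = mergeAux y k) ∨ ∃ k ≤ y.length, x = insertC y k

/-- `cprec x y` is the relation `x ⪯ y` on compositions. -/
def cprec (x y : Comp) : Prop := Relation.ReflTransGen cstep y x

/-- The value of the merge differential `∂_M^∞` on a basis element (it is `0` when `ℓ = 0`). -/
noncomputable def dMval (x : MComp) : MComp →₀ ℤ :=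
  if x.1.length = 0 then 0
  else -∑ k ∈ Finset.range (x.1.length + 1), Finsupp.single (mergeM x k) ((-1 : ℤ) ^ k)

/-- The value of the insert differential `∂_I^∞` on a basis element. -/
noncomputable def dIval (x : MComp) : MComp →₀ ℤ :=
  ∑ k ∈ Finset.range (x.1.length + 1), Finsupp.single (insertM x k) ((-1 : ℤ) ^ k)

/-- The merge differential `∂_M^∞` on `ℤ[Ω^∞]`. -/
noncomputable def dM : (MComp →₀ ℤ) →ₗ[ℤ] (MComp →₀ ℤ) :=
  Finsupp.lsum ℤ fun x => LinearMap.toSpanSingleton ℤ (MComp →₀ ℤ) (dMval x)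

/-- The insert differential `∂_I^∞` on `ℤ[Ω^∞]`. -/
noncomputable def dI : (MComp →₀ ℤ) →ₗ[ℤ] (MComp →₀ ℤ) :=
  Finsupp.lsum ℤ fun x => LinearMap.toSpanSingleton ℤ (MComp →₀ ℤ) (dIval x)

/-- The truncated differential `∂^∞` at level `m`: `∂_M^∞ x + ∂_I^∞ x` when `|x| < m`
(indeed whenever `|x| ≠ m`) and `∂_M^∞ x` when `|x| = m`. -/
noncomputable def dInf (m : ℕ) : (MComp →₀ ℤ) →ₗ[ℤ] (MComp →₀ ℤ) :=
  Finsupp.lsum ℤ fun x => LinearMap.toSpanSingleton ℤ (MComp →₀ ℤ)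
    (if normM x = m then dMval x else dMval x + dIval x)

/-- Prepend a part to a marked composition. -/
def consM (a : PNat) (x : MComp) : MComp := (a :: x.1, x.2)

/-- Recursive form of the merge `M_{n+1}^∞`. -/
def mF : ℕ → List PNat → ℕ → MComp
  | _, [], κ => ([], κ)
  | 0, [a], κ => ([], κ + (a : ℕ))
  | 0, a :: b :: t, κ => ((a + b) :: t, κ)
  | n + 1, a :: t, κ => consM a (mF n t κ)

theorem mergeM_zero_cons (a : PNat) (t : List PNat) (κ : ℕ) :
    mergeM (a :: t, κ) 0 = (t, κ + (a : ℕ)) := rfl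

theorem mergeM_succ (n : ℕ) (ω : List PNat) (κ : ℕ) (h : n < ω.length) :
    mergeM (ω, κ) (n + 1) = mF n ω κ := by
  induction n generalizing ω with
  | zero =>
    match ω, h with
    | [a], _ => simp [mergeM, mF]
    | a :: b :: t, _ => simp [mergeM, mF, mergeAux]
  | succ n ih =>
    match ω, h with
    | a :: t, h =>
      have h' : n < t.length := by simpa using h
      rw [mF, ← ih t h']
      match t, h' with
      | b :: t, h' =>
        by_cases hn : n = t.length
        · subst hn
          simp [mergeM, consM, List.getLast?_cons_cons]
          cases hL : (b :: t).getLast? with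
          | none => simp at hL
          | some c => simp
        · simp [mergeM, consM, hn, mergeAux]

theorem mF_length (n : ℕ) (ω : List PNat) (κ : ℕ) (h : n < ω.length) :
    (mF n ω κ).1.length + 1 = ω.length := by
  induction n generalizing ω with
  | zero =>
    match ω, h with
    | [a], _ => simp [mF]
    | a :: b :: t, _ => simp [mF]
  | succ n ih =>
    match ω, h with
    | a :: t, h =>
      have h' : n < t.length := by simpa using h
      simp [mF, consM, ih t h']

theorem mF_norm (n : ℕ) (ω : List PNat) (κ : ℕ) (h : n < ω.length) :
    normM (mF n ω κ) = normM (ω, κ) := by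
  induction n generalizing ω with
  | zero =>
    match ω, h with
    | [a], _ => simp [mF, normM, normC]; omega
    | a :: b :: t, _ => simp [mF, normM, normC]; omega
  | succ n ih =>
    match ω, h with
    | a :: t, h =>
      have h' : n < t.length := by simpa using h
      have := ih t h'
      simp [mF, consM, normM, normC] at this ⊢
      omega

theorem mergeM_length (x : MComp) (k : ℕ) (hk : k ≤ x.1.length) (hx : x.1 ≠ []) :
    (mergeM x k).1.length + 1 = x.1.length := by
  obtain ⟨ω, κ⟩ := x
  cases k with
  | zero =>
    cases ω with
    | nil => simp at hx
    | cons a t => simp [mergeM_zero_cons]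
  | succ n => rw [mergeM_succ n ω κ hk]; exact mF_length n ω κ hk

theorem mergeM_norm (x : MComp) (k : ℕ) (hk : k ≤ x.1.length) (hx : x.1 ≠ []) :
    normM (mergeM x k) = normM x := by
  obtain ⟨ω, κ⟩ := x
  cases k with
  | zero =>
    cases ω with
    | nil => simp at hx
    | cons a t => simp [mergeM_zero_cons, normM, normC]; omega
  | succ n => rw [mergeM_succ n ω κ hk]; exact mF_norm n ω κ hk

theorem insertC_zero (ω : List PNat) : insertC ω 0 = 2 :: ω := rfl

theorem insertC_cons (a : PNat) (t : List PNat) (k : ℕ) :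
    insertC (a :: t) (k + 1) = a :: insertC t k := rfl

theorem insertC_length (ω : List PNat) (k : ℕ) (hk : k ≤ ω.length) :
    (insertC ω k).length = ω.length + 1 := by
  simp [insertC]; omega

theorem insertC_norm (ω : List PNat) (k : ℕ) : normC (insertC ω k) = normC ω + 2 := by
  induction k generalizing ω with
  | zero => simp [insertC_zero, normC]; omega
  | succ k ih =>
    cases ω with
    | nil => simp [insertC, normC]
    | cons a t =>
      have := ih t
      simp [insertC_cons, normC] at this ⊢
      omega

theorem insertM_norm (x : MComp) (k : ℕ) : normM (insertM x k) = normM x + 2 := by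
  simp [insertM, normM, insertC_norm]; omega

theorem length_le_normC (ω : List PNat) : ω.length ≤ normC ω := by
  induction ω with
  | nil => simp
  | cons a t ih =>
    have := a.pos
    simp [normC] at ih ⊢
    omega

theorem rnorm_add (x : MComp) : rnormM x + x.1.length = normM x := by
  have := length_le_normC x.1
  simp [rnormM, rnormC, normM]; omega

/-! ### Simplicial identities -/

theorem mF_mF (i j : ℕ) (ω : List PNat) (κ : ℕ) (hij : i ≤ j) (h : j + 1 < ω.length) :
    mF i (mF (j + 1) ω κ).1 (mF (j + 1) ω κ).2 = mF j (mF i ω κ).1 (mF i ω κ).2 := by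
  induction i generalizing ω j with
  | zero =>
    match ω, h with
    | a :: b :: t, h =>
      cases j with
      | zero =>
        cases t with
        | nil => simp [mF, consM]; omega
        | cons c t => simp [mF, consM, add_assoc]
      | succ j => simp [mF, consM]
  | succ i ih =>
    match ω, j, hij, h with
    | a :: t, j + 1, hij, h =>
      simp only [mF, consM]
      rw [ih j t (by omega) (by simpa using h)]

theorem merge_merge (x : MComp) (i j : ℕ) (hij : i < j) (hj : j ≤ x.1.length)
    (hx : 2 ≤ x.1.length) :
    mergeM (mergeM x j) i = mergeM (mergeM x i) (j - 1) := by
  obtain ⟨ω, κ⟩ := x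
  obtain ⟨j, rfl⟩ : ∃ j', j = j' + 1 := ⟨j - 1, by omega⟩
  simp only at hj hx
  have hl := mF_length j ω κ hj
  rw [mergeM_succ j ω κ hj]
  cases i with
  | zero =>
    match ω, hx, hj with
    | a :: b :: t, hx, hj =>
      cases j with
      | zero => simp [mF, mergeM_zero_cons]; omega
      | succ j =>
        have h2 : j < (b :: t).length := by simpa using hj
        rw [mergeM_zero_cons, Nat.add_sub_cancel, mergeM_succ _ _ _ h2]
        simp only [mF, consM, mergeM_zero_cons]
        have key : ∀ (n : ℕ) (ω : List PNat) (κ c : ℕ),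
            mF n ω (κ + c) = ((mF n ω κ).1, (mF n ω κ).2 + c) := by
          intro n
          induction n with
          | zero =>
            intro ω κ c
            match ω with
            | [] => simp [mF]
            | [a] => simp [mF]; omega
            | a :: b :: t => simp [mF]
          | succ n ih =>
            intro ω κ c
            match ω with
            | [] => simp [mF]
            | a :: t => simp [mF, consM, ih]
        rw [key]
  | succ i =>
    obtain ⟨j, rfl⟩ : ∃ j', j = j' + 1 := ⟨j - 1, by omega⟩
    have hi := mF_length i ω κ (by omega)
    rw [mergeM_succ i ω κ (by omega), Nat.add_sub_cancel]
    have e1 := mergeM_succ i (mF (j + 1) ω κ).1 (mF (j + 1) ω κ).2 (by omega)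
    have e2 := mergeM_succ j (mF i ω κ).1 (mF i ω κ).2 (by omega)
    exact e1.trans ((mF_mF i j ω κ (by omega) hj).trans e2.symm)

theorem insert_insert (ω : List PNat) (i j : ℕ) (hij : i ≤ j) (hj : j ≤ ω.length) :
    insertC (insertC ω i) (j + 1) = insertC (insertC ω j) i := by
  induction i generalizing ω j with
  | zero => simp [insertC_zero, insertC_cons]
  | succ i ih =>
    match ω, j, hij, hj with
    | [], j + 1, hij, hj => simp at hj
    | a :: t, j + 1, hij, hj =>
      simp only [insertC_cons]
      rw [ih t j (by omega) (by simpa using hj)]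

theorem mF_insert_lt (n k : ℕ) (ω : List PNat) (κ : ℕ) (h : n ≤ k) (hk : k + 2 ≤ ω.length) :
    mF n (insertC ω (k + 2)) κ = insertM (mF n ω κ) (k + 1) := by
  induction n generalizing ω k with
  | zero =>
    match ω, hk with
    | a :: b :: t, hk => simp [mF, insertC_cons, insertM]
  | succ n ih =>
    match ω, k, h, hk with
    | a :: t, k + 1, h, hk =>
      rw [insertC_cons]
      simp only [mF]
      rw [ih k t (by omega) (by simpa using hk)]
      rfl

theorem mF_insert_gt (n k : ℕ) (ω : List PNat) (κ : ℕ) (h : k ≤ n) (hn : n < ω.length) :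
    mF (n + 1) (insertC ω k) κ = insertM (mF n ω κ) k := by
  induction k generalizing ω n with
  | zero => simp [mF, insertC_zero, insertM, consM]
  | succ k ih =>
    match ω, n, h, hn with
    | a :: t, n + 1, h, hn =>
      rw [insertC_cons]
      simp only [mF]
      have := ih n t (by omega) (by simpa using hn)
      rw [this]
      rfl

theorem mF_insert_diag (k : ℕ) (ω : List PNat) (κ : ℕ) (h : k < ω.length) :
    mF k (insertC ω k) κ = mF k (insertC ω (k + 1)) κ := by
  induction k generalizing ω with
  | zero =>
    match ω, h with
    | a :: t, _ => simp [mF, insertC_cons, insertC_zero, add_comm]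
  | succ k ih =>
    match ω, h with
    | a :: t, h =>
      simp only [insertC_cons, mF]
      rw [ih t (by simpa using h)]

theorem mF_insert_last (ω : List PNat) (κ : ℕ) :
    mF ω.length (insertC ω ω.length) κ = (ω, κ + 2) := by
  induction ω with
  | nil => simp [mF, insertC]
  | cons a t ih =>
    rw [List.length_cons, insertC_cons, mF, ih]
    rfl

theorem merge_insert_lt (x : MComp) (j k : ℕ) (h : j < k) (hk : k ≤ x.1.length) :
    mergeM (insertM x k) j = insertM (mergeM x j) (k - 1) := by
  obtain ⟨ω, κ⟩ := x
  simp only at hk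
  obtain ⟨k, rfl⟩ : ∃ j', k = j' + 1 := ⟨k - 1, by omega⟩
  have hl := insertC_length ω (k + 1) hk
  cases j with
  | zero =>
    match ω, hk with
    | a :: t, hk => rfl
  | succ j =>
    obtain ⟨k, rfl⟩ : ∃ j', k = j' + 1 := ⟨k - 1, by omega⟩
    rw [mergeM_succ j ω κ (by omega), insertM, mergeM_succ _ _ _ (by simp only; omega)]
    exact mF_insert_lt j k ω κ (by omega) hk

theorem merge_insert_gt (x : MComp) (j k : ℕ) (h : k + 1 < j) (hj : j ≤ x.1.length + 1) :
    mergeM (insertM x k) j = insertM (mergeM x (j - 1)) k := by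
  obtain ⟨ω, κ⟩ := x
  simp only at hj
  obtain ⟨j, rfl⟩ : ∃ j', j = j' + 2 := ⟨j - 2, by omega⟩
  have hl := insertC_length ω k (by omega)
  rw [show j + 2 - 1 = j + 1 by omega, mergeM_succ j ω κ (by omega), insertM,
    mergeM_succ _ _ _ (by simp only; omega)]
  exact mF_insert_gt j k ω κ (by omega) (by omega)

theorem merge_insert_diag (x : MComp) (k : ℕ) (h : k < x.1.length) :
    mergeM (insertM x k) (k + 1) = mergeM (insertM x (k + 1)) (k + 1) := by
  obtain ⟨ω, κ⟩ := x
  simp only at h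
  have hl := insertC_length ω k (by omega)
  have hl' := insertC_length ω (k + 1) (by omega)
  rw [insertM, insertM, mergeM_succ _ _ _ (by simp only; omega),
    mergeM_succ _ _ _ (by simp only; omega)]
  exact mF_insert_diag k ω κ h

theorem merge_insert_last (x : MComp) :
    mergeM (insertM x x.1.length) (x.1.length + 1) = mergeM (insertM x 0) 0 := by
  obtain ⟨ω, κ⟩ := x
  have hl := insertC_length ω ω.length le_rfl
  rw [insertM, mergeM_succ _ _ _ (by simp only; omega), mF_insert_last]
  rfl

/-! ### Alternating sums -/

theorem alt_sum_zero {A : Type*} [AddCommGroup A] (n : ℕ) (h : ℕ → ℕ → A)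
    (hh : ∀ i j, i < j → j ≤ n → h j i = h i (j - 1)) :
    ∑ j ∈ Finset.range (n + 1), ∑ i ∈ Finset.range n, ((-1 : ℤ) ^ (j + i)) • h j i = 0 := by
  rw [← Finset.sum_product']
  refine Finset.sum_involution
    (fun p _ => if p.2 < p.1 then (p.2, p.1 - 1) else (p.2 + 1, p.1)) ?_ ?_ ?_ ?_
  · rintro ⟨j, i⟩ hp
    simp only [Finset.mem_product, Finset.mem_range] at hp
    by_cases hij : i < j
    · simp only [hij, if_true]
      obtain ⟨j, rfl⟩ : ∃ j', j = j' + 1 := ⟨j - 1, by omega⟩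
      rw [hh i (j + 1) hij (by omega), Nat.add_sub_cancel, ← add_smul]
      rw [show (-1 : ℤ) ^ (j + 1 + i) + (-1) ^ (i + j) = 0 by ring, zero_smul]
    · simp only [hij, if_false]
      rw [hh j (i + 1) (by omega) (by omega), Nat.add_sub_cancel, ← add_smul]
      rw [show (-1 : ℤ) ^ (j + i) + (-1) ^ (i + 1 + j) = 0 by ring, zero_smul]
  · rintro ⟨j, i⟩ hp _
    by_cases hij : i < j
    · simp only [hij, if_true, ne_eq, Prod.mk.injEq]; omega
    · simp only [hij, if_false, ne_eq, Prod.mk.injEq]; omega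
  · rintro ⟨j, i⟩ hp
    simp only [Finset.mem_product, Finset.mem_range] at hp
    by_cases hij : i < j
    · simp only [hij, if_true, Finset.mem_product, Finset.mem_range]; omega
    · simp only [hij, if_false, Finset.mem_product, Finset.mem_range]; omega
  · rintro ⟨j, i⟩ hp
    by_cases hij : i < j
    · have : ¬ (j - 1 < i) := by omega
      grind
    · have : j < i + 1 := by omega
      grind

theorem cross_sum_zero {A : Type*} [AddCommGroup A] (n : ℕ) (a b : ℕ → ℕ → A)
    (h1 : ∀ k j, j < k → k ≤ n → a k j = b (k - 1) j)
    (h2 : ∀ k j, k + 1 < j → j ≤ n + 1 → a k j = b k (j - 1))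
    (h3 : ∀ k, k < n → a k (k + 1) = a (k + 1) (k + 1))
    (h4 : a n (n + 1) = a 0 0) :
    (∑ k ∈ Finset.range (n + 1), ∑ j ∈ Finset.range (n + 2), ((-1 : ℤ) ^ (k + j)) • a k j) +
    ∑ k ∈ Finset.range n, ∑ j ∈ Finset.range (n + 1), ((-1 : ℤ) ^ (k + j)) • b k j = 0 := by
  have hd : ∑ k ∈ Finset.range (n + 1), (a k k - a k (k + 1)) = 0 := by
    rw [Finset.sum_sub_distrib, Finset.sum_range_succ', Finset.sum_range_succ _ n, h4,
      Finset.sum_congr rfl fun k hk => h3 k (Finset.mem_range.1 hk)]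
    simp
  have hs : ∀ k ∈ Finset.range (n + 1),
      ∑ j ∈ Finset.range (n + 2), ((-1 : ℤ) ^ (k + j)) • a k j = (a k k - a k (k + 1)) +
        ∑ j ∈ Finset.range (n + 2),
          if j < k ∨ k + 1 < j then ((-1 : ℤ) ^ (k + j)) • a k j else 0 := by
    intro k hk
    have hk := Finset.mem_range.1 hk
    have e : ∀ j ∈ Finset.range (n + 2), ((-1 : ℤ) ^ (k + j)) • a k j =
        ((if k = j then a k j else 0) + (if k + 1 = j then - a k j else 0)) +
          if j < k ∨ k + 1 < j then ((-1 : ℤ) ^ (k + j)) • a k j else 0 := by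
      intro j _
      by_cases c1 : k = j
      · subst c1; simp [← two_mul]
      · by_cases c2 : k + 1 = j
        · subst c2; simp [show k + (k + 1) = 2 * k + 1 by ring, pow_succ]
        · have : j < k ∨ k + 1 < j := by omega
          simp [c1, c2, this]
    rw [Finset.sum_congr rfl e, Finset.sum_add_distrib, Finset.sum_add_distrib,
      Finset.sum_ite_eq, Finset.sum_ite_eq, if_pos (by simp; omega), if_pos (by simp; omega)]
    abel
  rw [Finset.sum_congr rfl hs, Finset.sum_add_distrib, hd, zero_add, ← Finset.sum_product',
    ← Finset.sum_product', ← Finset.sum_filter, ← eq_neg_iff_add_eq_zero,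
    ← Finset.sum_neg_distrib]
  refine Finset.sum_bij'
    (fun p _ => if p.2 < p.1 then (p.1 - 1, p.2) else (p.1, p.2 - 1))
    (fun p _ => if p.2 ≤ p.1 then (p.1 + 1, p.2) else (p.1, p.2 + 1)) ?_ ?_ ?_ ?_ ?_
  · rintro ⟨k, j⟩ hp
    simp only [Finset.mem_filter, Finset.mem_product, Finset.mem_range] at hp
    split_ifs <;> simp only [Finset.mem_product, Finset.mem_range] <;> omega
  · rintro ⟨k, j⟩ hp
    simp only [Finset.mem_product, Finset.mem_range] at hp
    split_ifs <;> simp only [Finset.mem_filter, Finset.mem_product, Finset.mem_range] <;> omega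
  · rintro ⟨k, j⟩ hp
    simp only [Finset.mem_filter, Finset.mem_product, Finset.mem_range] at hp
    by_cases c : j < k
    · have : j ≤ k - 1 := by omega
      grind
    · have : ¬ j - 1 ≤ k := by omega
      grind
  · rintro ⟨k, j⟩ hp
    by_cases c : j ≤ k
    · have : j < k + 1 := by omega
      grind
    · have : ¬ j + 1 < k := by omega
      grind
  · rintro ⟨k, j⟩ hp
    simp only [Finset.mem_filter, Finset.mem_product, Finset.mem_range] at hp
    by_cases c : j < k
    · simp only [c, if_true]
      rw [h1 k j c (by omega), ← neg_smul]
      obtain ⟨k, rfl⟩ : ∃ j', k = j' + 1 := ⟨k - 1, by omega⟩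
      congr 1
      rw [Nat.add_sub_cancel]; ring
    · simp only [c, if_false]
      rw [h2 k j (by omega) (by omega), ← neg_smul]
      obtain ⟨j, rfl⟩ : ∃ j', j = j' + 1 := ⟨j - 1, by omega⟩
      congr 1
      rw [Nat.add_sub_cancel]; ring

/-! ### The differentials -/

theorem dM_single (x : MComp) (c : ℤ) : dM (Finsupp.single x c) = c • dMval x := by
  simp [dM]

theorem dI_single (x : MComp) (c : ℤ) : dI (Finsupp.single x c) = c • dIval x := by
  simp [dI]

theorem dInf_single (m : ℕ) (x : MComp) (c : ℤ) : dInf m (Finsupp.single x c) =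
    c • (if normM x = m then dMval x else dMval x + dIval x) := by
  simp [dInf]

theorem dMval_pos (x : MComp) (h : x.1.length ≠ 0) : dMval x =
    -∑ k ∈ Finset.range (x.1.length + 1), ((-1 : ℤ) ^ k) • Finsupp.single (mergeM x k) 1 := by
  simp [dMval, h]

theorem dIval_eq (x : MComp) : dIval x =
    ∑ k ∈ Finset.range (x.1.length + 1), ((-1 : ℤ) ^ k) • Finsupp.single (insertM x k) 1 := by
  simp [dIval]

theorem dM_dMval (x : MComp) : dM (dMval x) = 0 := by
  by_cases h0 : x.1.length = 0
  · simp [dMval, h0]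
  have hne : x.1 ≠ [] := fun h => h0 (by simp [h])
  rw [dMval_pos x h0, map_neg, map_sum, neg_eq_zero]
  by_cases h1 : x.1.length = 1
  · refine Finset.sum_eq_zero fun k hk => ?_
    have := mergeM_length x k (by simpa [Nat.lt_succ_iff] using hk) hne
    rw [map_smul, dM_single, dMval, if_pos (by omega)]
    simp
  · have := alt_sum_zero x.1.length
      (fun j i => (Finsupp.single (mergeM (mergeM x j) i) 1 : MComp →₀ ℤ)) (by
        intro i j hij hj
        simp only [merge_merge x i j hij hj (by omega)])
    rw [← neg_eq_zero, ← Finset.sum_neg_distrib, ← this]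
    refine Finset.sum_congr rfl fun k hk => ?_
    have hl := mergeM_length x k (by simpa [Nat.lt_succ_iff] using hk) hne
    rw [map_smul, dM_single, dMval_pos _ (by omega), hl, one_smul, smul_neg, neg_neg,
      Finset.smul_sum]
    refine Finset.sum_congr rfl fun i _ => ?_
    rw [smul_smul, ← pow_add]

theorem dI_dIval (x : MComp) : dI (dIval x) = 0 := by
  have := alt_sum_zero (x.1.length + 1)
    (fun j i => (Finsupp.single (insertM (insertM x i) j) 1 : MComp →₀ ℤ)) (by
      intro i j hij hj
      obtain ⟨j, rfl⟩ : ∃ j', j = j' + 1 := ⟨j - 1, by omega⟩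
      simp only [insertM, Nat.add_sub_cancel]
      rw [insert_insert x.1 i j (by omega) (by omega)])
  rw [Finset.sum_comm] at this
  rw [dIval_eq, map_sum, ← this]
  refine Finset.sum_congr rfl fun k hk => ?_
  have hl : (insertM x k).1.length = x.1.length + 1 :=
    insertC_length x.1 k (by simpa [Nat.lt_succ_iff] using hk)
  rw [map_smul, dI_single, dIval_eq, hl, one_smul, Finset.smul_sum]
  refine Finset.sum_congr rfl fun i _ => ?_
  rw [smul_smul, ← pow_add, add_comm k i]

theorem dM_dI_cross (x : MComp) : dM (dIval x) + dI (dMval x) = 0 := by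
  have key := cross_sum_zero x.1.length
    (fun k j => (Finsupp.single (mergeM (insertM x k) j) 1 : MComp →₀ ℤ))
    (fun k j => (Finsupp.single (insertM (mergeM x j) k) 1 : MComp →₀ ℤ))
    (fun k j h hk => by simp only [merge_insert_lt x j k h hk])
    (fun k j h hk => by simp only [merge_insert_gt x j k h hk])
    (fun k h => by simp only [merge_insert_diag x k h])
    (by simp only [merge_insert_last x])
  have e1 : dM (dIval x) = -∑ k ∈ Finset.range (x.1.length + 1),
      ∑ j ∈ Finset.range (x.1.length + 2),
        ((-1 : ℤ) ^ (k + j)) • Finsupp.single (mergeM (insertM x k) j) 1 := by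
    rw [dIval_eq, map_sum, ← Finset.sum_neg_distrib]
    refine Finset.sum_congr rfl fun k hk => ?_
    have hl : (insertM x k).1.length = x.1.length + 1 :=
      insertC_length x.1 k (by simpa [Nat.lt_succ_iff] using hk)
    rw [map_smul, dM_single, dMval_pos _ (by omega), hl, one_smul, smul_neg, Finset.smul_sum]
    congr 1
    refine Finset.sum_congr rfl fun i _ => ?_
    rw [smul_smul, ← pow_add]
  have e2 : dI (dMval x) = -∑ k ∈ Finset.range x.1.length,
      ∑ j ∈ Finset.range (x.1.length + 1),
        ((-1 : ℤ) ^ (k + j)) • Finsupp.single (insertM (mergeM x j) k) 1 := by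
    by_cases h0 : x.1.length = 0
    · simp [dMval, h0]
    have hne : x.1 ≠ [] := fun h => h0 (by simp [h])
    rw [dMval_pos x h0, map_neg, map_sum, Finset.sum_comm]
    congr 1
    refine Finset.sum_congr rfl fun k hk => ?_
    have hl := mergeM_length x k (by simpa [Nat.lt_succ_iff] using hk) hne
    rw [map_smul, dI_single, dIval_eq, hl, one_smul, Finset.smul_sum]
    refine Finset.sum_congr rfl fun i _ => ?_
    rw [smul_smul, ← pow_add, add_comm k i]
  rw [e1, e2, ← neg_add, key, neg_zero]

theorem dMval_mem (x : MComp) (S : Set MComp)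
    (h : ∀ k ≤ x.1.length, x.1 ≠ [] → mergeM x k ∈ S) : dMval x ∈ Finsupp.supported ℤ ℤ S := by
  by_cases h0 : x.1.length = 0
  · simp [dMval, h0]
  have hne : x.1 ≠ [] := fun h => h0 (by simp [h])
  rw [dMval, if_neg h0]
  refine Submodule.neg_mem _ (Submodule.sum_mem _ fun k hk => ?_)
  exact Finsupp.single_mem_supported ℤ _ (h k (by simpa [Nat.lt_succ_iff] using hk) hne)

theorem dIval_mem (x : MComp) (S : Set MComp)
    (h : ∀ k ≤ x.1.length, insertM x k ∈ S) : dIval x ∈ Finsupp.supported ℤ ℤ S := by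
  refine Submodule.sum_mem _ fun k hk => ?_
  exact Finsupp.single_mem_supported ℤ _ (h k (by simpa [Nat.lt_succ_iff] using hk))

/-- Linear induction on the elements supported in a set. -/
theorem supported_ind (S : Set MComp) (p : Submodule ℤ (MComp →₀ ℤ))
    (h : ∀ x ∈ S, Finsupp.single x 1 ∈ p) (v : MComp →₀ ℤ)
    (hv : v ∈ Finsupp.supported ℤ ℤ S) : v ∈ p := by
  rw [Finsupp.supported_eq_span_single] at hv
  refine Submodule.span_le.2 ?_ hv
  rintro _ ⟨x, hx, rfl⟩
  exact h x hx

theorem dInf_top (m : ℕ) (v : MComp →₀ ℤ)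
    (hv : v ∈ Finsupp.supported ℤ ℤ {y : MComp | normM y = m}) : dInf m v = dM v := by
  refine supported_ind {y : MComp | normM y = m} (LinearMap.eqLocus (dInf m) dM) ?_ v hv
  intro x hx
  have hx : normM x = m := hx
  simp [LinearMap.mem_eqLocus, dInf_single, dM_single, hx]

theorem dInf_low (m n : ℕ) (hn : n ≠ m) (v : MComp →₀ ℤ)
    (hv : v ∈ Finsupp.supported ℤ ℤ {y : MComp | normM y = n}) : dInf m v = dM v + dI v := by
  refine supported_ind {y : MComp | normM y = n} (LinearMap.eqLocus (dInf m) (dM + dI)) ?_ v hv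
  intro x hx
  have hx : normM x = n := hx
  simp [LinearMap.mem_eqLocus, dInf_single, dM_single, dI_single, hx, hn]

/-- For every `d ≥ 0` and every closed `Θ ⊆ Ω^∞_{⟨d]}`, the truncated
differential `∂^∞` maps `ℤ[Θ]` into itself, squares to zero there, and raises the
reduced norm by exactly `1` on basis elements. -/
theorem truncated_differential_complex (d : ℕ) (Θ : Set MComp)
    (hsub : Θ ⊆ {x : MComp | normM x ≤ d ∧ normM x % 2 = d % 2})
    (hclosed : ∀ y ∈ Θ, ∀ x : MComp, mprec x y → normM x ≤ d → x ∈ Θ) :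
    (∀ v ∈ Finsupp.supported ℤ ℤ Θ, dInf d v ∈ Finsupp.supported ℤ ℤ Θ) ∧
    (∀ v ∈ Finsupp.supported ℤ ℤ Θ, dInf d (dInf d v) = 0) ∧
    (∀ x ∈ Θ, dInf d (Finsupp.single x 1) ∈
      Finsupp.supported ℤ ℤ {y : MComp | rnormM y = rnormM x + 1}) := by
  have hM : ∀ x, dMval x ∈ Finsupp.supported ℤ ℤ {y : MComp | normM y = normM x} :=
    fun x => dMval_mem x _ fun k hk hx => mergeM_norm x k hk hx
  have hI : ∀ x, dIval x ∈ Finsupp.supported ℤ ℤ {y : MComp | normM y = normM x + 2} :=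
    fun x => dIval_mem x _ fun k _ => insertM_norm x k
  have hMr : ∀ x, dMval x ∈ Finsupp.supported ℤ ℤ {y : MComp | rnormM y = rnormM x + 1} := by
    refine fun x => dMval_mem x _ fun k hk hx => ?_
    have e1 := mergeM_norm x k hk hx
    have e2 := mergeM_length x k hk hx
    have e3 := rnorm_add x
    have e4 := rnorm_add (mergeM x k)
    show rnormM _ = _
    omega
  have hIr : ∀ x, dIval x ∈ Finsupp.supported ℤ ℤ {y : MComp | rnormM y = rnormM x + 1} := by
    refine fun x => dIval_mem x _ fun k hk => ?_
    have e1 := insertM_norm x k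
    have e2 : (insertM x k).1.length = x.1.length + 1 := insertC_length x.1 k hk
    have e3 := rnorm_add x
    have e4 := rnorm_add (insertM x k)
    show rnormM _ = _
    omega
  have hMt : ∀ x ∈ Θ, dMval x ∈ Finsupp.supported ℤ ℤ Θ := by
    refine fun x hxΘ => dMval_mem x _ fun k hk hx => ?_
    refine hclosed x hxΘ _ (Relation.ReflTransGen.single (Or.inl ⟨k, hk, hx, rfl⟩)) ?_
    rw [mergeM_norm x k hk hx]
    exact (hsub hxΘ).1
  have hIt : ∀ x ∈ Θ, normM x ≠ d → dIval x ∈ Finsupp.supported ℤ ℤ Θ := by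
    refine fun x hxΘ hd => dIval_mem x _ fun k hk => ?_
    refine hclosed x hxΘ _ (Relation.ReflTransGen.single (Or.inr ⟨k, hk, rfl⟩)) ?_
    rw [insertM_norm x k]
    have := hsub hxΘ
    simp only [Set.mem_ofPred_eq] at this
    omega
  refine ⟨fun v hv => ?_, fun v hv => ?_, fun x hx => ?_⟩
  · refine supported_ind Θ ((Finsupp.supported ℤ ℤ Θ).comap (dInf d)) ?_ v hv
    intro x hx
    rw [Submodule.mem_comap, dInf_single, one_smul]
    split_ifs with h
    · exact hMt x hx
    · exact Submodule.add_mem _ (hMt x hx) (hIt x hx h)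
  · refine supported_ind Θ (LinearMap.ker (dInf d ∘ₗ dInf d)) ?_ v hv
    intro x hx
    rw [LinearMap.mem_ker, LinearMap.comp_apply, dInf_single, one_smul]
    split_ifs with h
    · rw [dInf_top d _ (h ▸ hM x), dM_dMval]
    · rw [map_add, dInf_low d _ h _ (hM x), dM_dMval, zero_add]
      have hc := dM_dI_cross x
      by_cases h2 : normM x + 2 = d
      · rw [dInf_top d _ (h2 ▸ hI x), add_comm, hc]
      · rw [dInf_low d _ h2 _ (hI x), dI_dIval, add_zero, add_comm, hc]
  · rw [dInf_single, one_smul]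
    split_ifs with h
    · exact hMr x
    · exact Submodule.add_mem _ (hMr x) (hIr x)
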